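/- arXiv:1612.01672 — 2 statements merged into one kernel-verified Lean document; each statement's English description precedes it below -/
import Mathlib

section
/- Let ‖·‖ be a norm on ℝ^b, Γ a full-rank lattice of covolume 1, and V the volume of the unit ball of ‖·‖. Then the function ζ(z) = ∑_{θ ∈ Γ, θ ≠ 0} ‖θ‖^{-z}, defined for real z > b, satisfies lim_{z → b⁺} (z − b)·ζ(z) = b·V. -/
open MeasureTheory Filter

lemma aux_bound (b : ℕ) (A : ℝ → ℝ) (t0 : ℝ) (ht0 : 0 < t0) (hmono : Monotone A)
    (hzero : ∀ t, t < t0 → A t = 0) (V : ℝ)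
    (hA : Tendsto (fun t => A t / t ^ b) atTop (nhds V)) :
    ∃ C : ℝ, 0 ≤ C ∧ ∀ t, 0 < t → A t / t ^ b ≤ C := by
  obtain ⟨T, hT⟩ := eventually_atTop.1 (hA.eventually (eventually_le_nhds (lt_add_one V)))
  refine ⟨max (max 0 (V + 1)) (A T / t0 ^ b), by simp, fun t ht => ?_⟩
  rcases lt_or_ge t t0 with h | h
  · rw [hzero t h]; simp
  · rcases le_or_gt T t with h' | h'
    · exact (hT t h').trans ((le_max_right _ _).trans (le_max_left _ _))
    · refine le_trans ?_ (le_max_right _ _)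
      have h0 : 0 ≤ A T := by
        rw [← hzero (min T (t0 / 2)) ((min_le_right _ _).trans_lt (by linarith))]
        exact hmono (min_le_left _ _)
      gcongr
      exact hmono h'.le

lemma aux_lint (a c : ℝ) (ha : 0 < a) :
    ∫⁻ u in Set.Ici c, ENNReal.ofReal (Real.exp (-a * u)) =
      ENNReal.ofReal (Real.exp (-a * c) / a) := by
  rw [setLIntegral_congr Ioi_ae_eq_Ici.symm, ← ofReal_integral_eq_lintegral_ofReal,
    integral_exp_mul_Ioi (by linarith)]
  · congr 1; field_simp
  · exact integrableOn_exp_mul_Ioi (by linarith) c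
  · exact Eventually.of_forall fun x => (Real.exp_pos _).le

lemma aux_abs {ι : Type*} [Countable ι] (b : ℕ) (n : ι → ℝ) (t0 : ℝ) (ht0 : 0 < t0)
    (hn : ∀ i, t0 ≤ n i) (hfin : ∀ t, {i | n i ≤ t}.Finite) (V : ℝ)
    (hA : Tendsto (fun t : ℝ => (Nat.card {i | n i ≤ t} : ℝ) / t ^ b) atTop (nhds V)) :
    Tendsto (fun z : ℝ => (z - b) * ∑' i, n i ^ (-z))
      (nhdsWithin (b : ℝ) (Set.Ioi (b : ℝ))) (nhds (b * V)) := by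
  set A : ℝ → ℝ := fun t => (Nat.card {i | n i ≤ t} : ℝ) with hAdef
  have hA0 : ∀ t, 0 ≤ A t := fun t => Nat.cast_nonneg _
  have hV : 0 ≤ V := ge_of_tendsto hA (by
    filter_upwards [eventually_gt_atTop 0] with t ht
    have := hA0 t
    positivity)
  have hmono : Monotone A := fun s t h => by
    simp only [hAdef]
    exact_mod_cast Nat.card_mono (hfin t) (fun i hi => le_trans hi h)
  have hzero : ∀ t, t < t0 → A t = 0 := fun t ht => by
    have : {i | n i ≤ t} = ∅ := by
      ext i
      simpa using ht.trans_le (hn i)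
    simp only [hAdef]
    rw [this]; simp
  obtain ⟨C, hC0, hC⟩ := aux_bound b A t0 ht0 hmono hzero V hA
  have hG : ∀ t, ∑' i, (if n i ≤ t then (1 : ENNReal) else 0) = ENNReal.ofReal (A t) := fun t => by
    have h1 : (fun i => if n i ≤ t then (1 : ENNReal) else 0) =
        {i | n i ≤ t}.indicator (fun _ => 1) := by
      ext i; simp [Set.indicator]
    rw [h1, ← tsum_subtype]
    have := (hfin t).fintype
    rw [tsum_fintype]
    simp [hAdef]
  -- the integral
  let F : ℝ → ℝ → ENNReal := fun z u =>
    ENNReal.ofReal (A (Real.exp (u / (z - b)))) * ENNReal.ofReal (Real.exp (-(z / (z - b)) * u))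
  have hn0 : ∀ i, 0 < n i := fun i => ht0.trans_le (hn i)
  have hF : ∀ z : ℝ, (b : ℝ) < z → ∫⁻ u, F z u = ∑' i, ENNReal.ofReal ((z - b) / z * n i ^ (-z)) := by
    intro z hz
    have hs : 0 < z - b := by linarith
    have hz0 : 0 < z := lt_of_le_of_lt (Nat.cast_nonneg b) hz
    have e1 : ∀ u, F z u = ∑' i, (Set.Ici ((z - b) * Real.log (n i))).indicator
        (fun u => ENNReal.ofReal (Real.exp (-(z / (z - b)) * u))) u := by
      intro u
      simp only [F]
      rw [← hG, ← ENNReal.tsum_mul_right]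
      congr 1; ext i
      have : n i ≤ Real.exp (u / (z - b)) ↔ u ∈ Set.Ici ((z - b) * Real.log (n i)) := by
        rw [← Real.log_le_iff_le_exp (hn0 i), le_div_iff₀ hs, Set.mem_Ici, mul_comm]
      simp only [Set.indicator, this]
      split_ifs <;> simp
    simp_rw [e1]
    rw [lintegral_tsum]
    · congr 1; ext i
      rw [lintegral_indicator measurableSet_Ici, aux_lint _ _ (by positivity)]
      congr 1
      rw [Real.rpow_def_of_pos (hn0 i)]
      rw [show -(z / (z - b)) * ((z - b) * Real.log (n i)) = Real.log (n i) * -z by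
        field_simp]
      field_simp
    · intro i
      exact ((by fun_prop : Measurable (fun u : ℝ =>
        ENNReal.ofReal (Real.exp (-(z / (z - b)) * u)))).indicator measurableSet_Ici).aemeasurable
  have hkey : ∀ z : ℝ, (b : ℝ) < z → (z - b) * ∑' i, n i ^ (-z) = z * (∫⁻ u, F z u).toReal := by
    intro z hz
    have hs : 0 < z - b := by linarith
    have hz0 : 0 < z := lt_of_le_of_lt (Nat.cast_nonneg b) hz
    rw [hF z hz, ENNReal.tsum_toReal_eq (fun _ => ENNReal.ofReal_ne_top)]
    have : ∀ i, (ENNReal.ofReal ((z - b) / z * n i ^ (-z))).toReal = (z - b) / z * n i ^ (-z) :=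
      fun i => ENNReal.toReal_ofReal (mul_nonneg (by positivity) (Real.rpow_nonneg (hn0 i).le _))
    simp_rw [this]
    rw [tsum_mul_left]
    field_simp
  have hfact : ∀ z : ℝ, (b : ℝ) < z → ∀ u, F z u =
      ENNReal.ofReal (A (Real.exp (u / (z - b))) / Real.exp (u / (z - b)) ^ b * Real.exp (-u)) := by
    intro z hz u
    have hs : z - b ≠ 0 := by linarith
    simp only [F]
    rw [← ENNReal.ofReal_mul (hA0 _), ← Real.exp_nat_mul, div_eq_mul_inv (A _), ← Real.exp_neg, mul_assoc,
      ← Real.exp_add]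
    congr 3
    field_simp
    ring
  have hlim : Tendsto (fun z => ∫⁻ u, F z u) (nhdsWithin (b : ℝ) (Set.Ioi (b : ℝ)))
      (nhds (∫⁻ u, (Set.Ici (0:ℝ)).indicator
        (fun u => ENNReal.ofReal (V * Real.exp (-u))) u)) := by
    refine tendsto_lintegral_filter_of_dominated_convergence
      ((Set.Ici (-|Real.log t0|)).indicator (fun u => ENNReal.ofReal (C * Real.exp (-u)))) ?_ ?_ ?_ ?_
    · refine Eventually.of_forall fun z => ?_
      have := hmono.measurable
      exact (by fun_prop : Measurable fun u => ENNReal.ofReal (A (Real.exp (u / (z - b)))) *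
        ENNReal.ofReal (Real.exp (-(z / (z - b)) * u)))
    · filter_upwards [Ioo_mem_nhdsGT (lt_add_one (b:ℝ))] with z hz
      refine Eventually.of_forall fun u => ?_
      rw [hfact z hz.1]
      have hs : 0 < z - b := by linarith [hz.1]
      by_cases hu : u ∈ Set.Ici (-|Real.log t0|)
      · rw [Set.indicator_of_mem hu]
        apply ENNReal.ofReal_le_ofReal
        gcongr
        exact hC _ (Real.exp_pos _)
      · rw [hzero]
        · simp
        · rw [← Real.lt_log_iff_exp_lt ht0, div_lt_iff₀ hs]
          simp only [Set.mem_Ici, not_le] at hu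
          have h1 := neg_abs_le (Real.log t0)
          have h2 := abs_nonneg (Real.log t0)
          nlinarith [hz.2]
    · rw [lintegral_indicator measurableSet_Ici]
      simp_rw [ENNReal.ofReal_mul hC0]
      rw [lintegral_const_mul _ (by fun_prop)]
      have := aux_lint 1 (-|Real.log t0|) one_pos
      simp only [neg_mul, one_mul] at this
      rw [this]
      exact ENNReal.mul_ne_top ENNReal.ofReal_ne_top ENNReal.ofReal_ne_top
    · have hne : ∀ᵐ u : ℝ, u ≠ 0 := by simp [ae_iff]
      filter_upwards [hne] with u hu
      have hs0 : Tendsto (fun z : ℝ => z - b) (nhdsWithin (b : ℝ) (Set.Ioi (b : ℝ)))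
          (nhdsWithin 0 (Set.Ioi 0)) := by
        refine tendsto_nhdsWithin_iff.2 ⟨?_, ?_⟩
        · have : Tendsto (fun z : ℝ => z - b) (nhds (b:ℝ)) (nhds ((b:ℝ) - b)) :=
            (continuous_id.sub continuous_const).tendsto _
          rw [sub_self] at this
          exact this.mono_left nhdsWithin_le_nhds
        · filter_upwards [self_mem_nhdsWithin] with z hz
          simpa using hz
      have hinv : Tendsto (fun z : ℝ => (z - b)⁻¹) (nhdsWithin (b : ℝ) (Set.Ioi (b : ℝ))) atTop :=
        tendsto_inv_nhdsGT_zero.comp hs0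
      rcases lt_or_gt_of_ne hu with h | h
      · rw [Set.indicator_of_notMem (by simpa using h)]
        have h1 : Tendsto (fun z : ℝ => Real.exp (u / (z - b)))
            (nhdsWithin (b : ℝ) (Set.Ioi (b : ℝ))) (nhds 0) := by
          refine Real.tendsto_exp_atBot.comp ?_
          simp_rw [div_eq_mul_inv]
          exact hinv.const_mul_atTop_of_neg h
        refine tendsto_const_nhds.congr' ?_
        filter_upwards [h1.eventually (eventually_lt_nhds ht0)] with z hz
        simp [F, hzero _ hz]
      · rw [Set.indicator_of_mem (by simpa using h.le)]
        have h1 : Tendsto (fun z : ℝ => Real.exp (u / (z - b)))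
            (nhdsWithin (b : ℝ) (Set.Ioi (b : ℝ))) atTop := by
          refine Real.tendsto_exp_atTop.comp ?_
          simp_rw [div_eq_mul_inv]
          exact hinv.const_mul_atTop h
        refine Tendsto.congr' ?_
          (ENNReal.tendsto_ofReal ((hA.comp h1).mul_const (Real.exp (-u))))
        filter_upwards [self_mem_nhdsWithin] with z hz
        rw [hfact z hz]; rfl
  have hval : (∫⁻ u, (Set.Ici (0:ℝ)).indicator
        (fun u => ENNReal.ofReal (V * Real.exp (-u))) u) = ENNReal.ofReal V := by
    rw [lintegral_indicator measurableSet_Ici]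
    simp_rw [ENNReal.ofReal_mul hV]
    rw [lintegral_const_mul _ (by fun_prop)]
    have := aux_lint 1 0 one_pos
    simp only [neg_mul, one_mul] at this
    rw [this]; simp
  rw [hval] at hlim
  have h2 := (ENNReal.tendsto_toReal ENNReal.ofReal_ne_top).comp hlim
  rw [ENNReal.toReal_ofReal hV] at h2
  have h3 : Tendsto (fun z : ℝ => z) (nhdsWithin (b : ℝ) (Set.Ioi (b : ℝ))) (nhds b) :=
    tendsto_id.mono_left nhdsWithin_le_nhds
  refine (h3.mul h2).congr' ?_
  filter_upwards [self_mem_nhdsWithin] with z hz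
  exact (hkey z hz).symm

theorem stmt_4 (b : ℕ)
    (Γ : Submodule ℤ (EuclideanSpace ℝ (Fin b))) [DiscreteTopology Γ] [IsZLattice ℝ Γ]
    (hΓ : ZLattice.covolume Γ = 1)
    (N : EuclideanSpace ℝ (Fin b) → ℝ)
    (hN0 : ∀ x, N x = 0 ↔ x = 0)
    (hNsmul : ∀ (c : ℝ) x, N (c • x) = |c| * N x)
    (hNadd : ∀ x y, N (x + y) ≤ N x + N y) :
    Tendsto (fun z : ℝ =>
        (z - b) * ∑' θ : {x : EuclideanSpace ℝ (Fin b) // x ∈ Γ ∧ x ≠ 0}, (N θ.1) ^ (-z))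
      (nhdsWithin (b : ℝ) (Set.Ioi (b : ℝ)))
      (nhds ((b : ℝ) * (volume {x : EuclideanSpace ℝ (Fin b) | N x ≤ 1}).toReal)) := by
  rcases Nat.eq_zero_or_pos b with rfl | hb
  · have : IsEmpty {x : EuclideanSpace ℝ (Fin 0) // x ∈ Γ ∧ x ≠ 0} :=
      ⟨fun x => x.2.2 (Subsingleton.elim _ _)⟩
    simp
  have : NeZero b := ⟨hb.ne'⟩
  have hnn : ∀ x, 0 ≤ N x := fun x => by
    have h1 := hNadd x ((-1 : ℝ) • x)
    rw [hNsmul] at h1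
    have h2 : x + (-1 : ℝ) • x = 0 := by simp
    rw [h2, (hN0 0).2 rfl] at h1
    norm_num at h1
    linarith
  have hcvx : ConvexOn ℝ Set.univ N := by
    refine ⟨convex_univ, fun x _ y _ p q hp hq _ => ?_⟩
    refine (hNadd _ _).trans ?_
    rw [hNsmul, hNsmul, abs_of_nonneg hp, abs_of_nonneg hq]
    rfl
  have hcont : Continuous N := continuousOn_univ.1 (hcvx.continuousOn isOpen_univ)
  obtain ⟨c, hc, hcN⟩ : ∃ c : ℝ, 0 < c ∧ ∀ x, c * ‖x‖ ≤ N x := by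
    obtain ⟨y, hy, hmin⟩ := (isCompact_sphere (0 : EuclideanSpace ℝ (Fin b)) 1).exists_isMinOn
      (NormedSpace.sphere_nonempty.2 zero_le_one) hcont.continuousOn
    have hy0 : y ≠ 0 := by
      rintro rfl
      simp at hy
    refine ⟨N y, lt_of_le_of_ne (hnn y) (fun h => hy0 ((hN0 y).1 h.symm)), fun x => ?_⟩
    by_cases hx : x = 0
    · subst hx; simp [hnn]
    · have hx' : 0 < ‖x‖ := norm_pos_iff.2 hx
      have h1 : N y ≤ N (‖x‖⁻¹ • x) := hmin (by simp [norm_smul, hx'.ne'])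
      rw [hNsmul, abs_of_pos (inv_pos.2 hx'), inv_mul_eq_div, le_div_iff₀ hx'] at h1
      exact h1
  have hbdd : ∀ t, Bornology.IsBounded {x | N x ≤ t} := fun t => by
    refine (Metric.isBounded_closedBall (x := (0 : EuclideanSpace ℝ (Fin b))) (r := t / c)).subset
      fun x hx => ?_
    rw [mem_closedBall_zero_iff, le_div_iff₀ hc, mul_comm]
    exact (hcN x).trans hx
  have hclosed : IsClosed (Γ : Set (EuclideanSpace ℝ (Fin b))) := by
    have : DiscreteTopology Γ.toAddSubgroup := inferInstanceAs (DiscreteTopology Γ)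
    rw [← Submodule.coe_toAddSubgroup]
    exact AddSubgroup.isClosed_of_discrete
  have hfinE : ∀ t, ({x | N x ≤ t} ∩ Γ).Finite := fun t =>
    Metric.finite_isBounded_inter_isClosed DiscreteTopology.isDiscrete (hbdd t) hclosed
  let ι := {x : EuclideanSpace ℝ (Fin b) // x ∈ Γ ∧ x ≠ 0}
  have : Countable ι := by
    have : Countable Γ := inferInstance
    exact Function.Injective.countable (f := fun x : ι => (⟨x.1, x.2.1⟩ : Γ))
      (fun x y h => Subtype.ext (congrArg (fun z : Γ => z.1) h))
  have himg : ∀ t, 0 ≤ t → ({x | N x ≤ t} ∩ (Γ : Set _)) =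
      insert 0 ((fun θ : ι => θ.1) '' {θ : ι | N θ.1 ≤ t}) := by
    intro t ht
    ext x
    by_cases hx : x = 0
    · subst hx; simp [(hN0 0).2 rfl, ht]
    · simp [hx, ι, and_comm]
  have hfin : ∀ t, {θ : ι | N θ.1 ≤ t}.Finite := fun t => by
    refine Set.Finite.of_finite_image ((hfinE t).subset ?_) Subtype.val_injective.injOn
    rintro _ ⟨θ, hθ, rfl⟩
    exact ⟨hθ, θ.2.1⟩
  have hpos : ∀ θ : ι, 0 < N θ.1 := fun θ =>
    lt_of_le_of_ne (hnn _) (fun h => θ.2.2 ((hN0 _).1 h.symm))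
  obtain ⟨t0, ht0, hle⟩ : ∃ t0 : ℝ, 0 < t0 ∧ ∀ θ : ι, t0 ≤ N θ.1 := by
    by_cases hne : {θ : ι | N θ.1 ≤ 1}.Nonempty
    · obtain ⟨θ, hθ, hm⟩ := Set.exists_min_image _ (fun θ : ι => N θ.1) (hfin 1) hne
      refine ⟨N θ.1, hpos θ, fun η => ?_⟩
      by_cases hη : N η.1 ≤ 1
      · exact hm η hη
      · exact le_trans hθ (not_le.1 hη).le
    · refine ⟨1, one_pos, fun θ => ?_⟩
      by_contra h
      exact hne ⟨θ, (not_le.1 h).le⟩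
  refine aux_abs b (fun θ : ι => N θ.1) t0 ht0 hle hfin _ ?_
  have hset : ∀ t : ℝ, 0 ≤ t → {x ∈ (Set.univ : Set (EuclideanSpace ℝ (Fin b))) | N x ^ b ≤ t ^ b}
      = {x | N x ≤ t} := by
    intro t ht
    ext x
    simp [pow_le_pow_iff_left₀ (hnn x) ht hb.ne']
  have hset1 := hset 1 zero_le_one
  rw [one_pow] at hset1
  have key := ZLattice.covolume.tendsto_card_le_div' Γ (X := Set.univ) (F := fun x => N x ^ b)
    (fun _ _ _ _ => trivial)
    (fun x r hr => by rw [hNsmul, abs_of_nonneg hr, mul_pow, finrank_euclideanSpace_fin])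
    (by rw [hset1]; exact hbdd 1)
    (by rw [hset1]; exact (isClosed_le hcont continuous_const).measurableSet)
    (by
      rw [hset1]
      have := hcvx.convex_le 1
      simp only [Set.mem_univ, true_and] at this
      exact this.addHaar_frontier _)
  rw [hset1, hΓ, div_one] at key
  have h1 := (key.comp (tendsto_pow_atTop (α := ℝ) hb.ne')).sub
    (tendsto_inv_atTop_zero.comp (tendsto_pow_atTop (α := ℝ) hb.ne'))
  rw [sub_zero] at h1
  refine h1.congr' ?_
  filter_upwards [eventually_gt_atTop 0] with t ht
  simp only [Function.comp_apply]
  rw [hset t ht.le, himg t ht.le, Nat.card_coe_set_eq, Nat.card_coe_set_eq,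
    Set.ncard_insert_of_notMem _ ((hfin t).image _),
    Set.ncard_image_of_injective _ Subtype.val_injective]
  · push_cast
    field_simp
    ring
  · rintro ⟨θ, -, h⟩
    exact θ.2.2 h
end

section
/- Let Γ be a full-rank lattice of covolume 1 in ℝ^b, ‖·‖ a norm with unit-ball volume V, and ℓ : Γ\{0} → ℝ_{>0} a function with |ℓ(θ) − ‖θ‖| ≤ C for all nonzero θ ∈ Γ. Then lim_{z → b⁺} (z − b)·∑_{θ ≠ 0} ℓ(θ)^{-z} = b·V, i.e. the perturbed zeta function has the same residue-type limit at z = b as the lattice zeta function. -/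
open MeasureTheory Filter
open Topology

lemma aux_ls {I : Type*} (k : I → ℕ) (hk : ∀ i, k i ≠ 0) (hfin : ∀ n, {i | k i ≤ n}.Finite)
    (V : ℝ) (hV : Tendsto (fun n : ℕ => ({i | k i ≤ n}.ncard : ℝ) / n) atTop (𝓝 V)) :
    (∀ s : ℝ, 1 < s → Summable (fun i => (k i : ℝ) ^ (-s))) ∧
    Tendsto (fun s : ℝ => (s - 1) * ∑' i, (k i : ℝ) ^ (-s)) (𝓝[>] 1) (𝓝 V) := by
  classical
  have hfib : ∀ n, {i | k i = n}.Finite := fun n => (hfin n).subset (fun i hi => le_of_eq hi)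
  let f : ℕ → ℝ := fun n => ({i | k i = n}.ncard : ℝ)
  have hsum : ∀ n, ∑ j ∈ Finset.Icc 1 n, f j = ({i | k i ≤ n}.ncard : ℝ) := by
    intro n
    simp only [f]
    rw [← Nat.cast_sum]
    congr 1
    rw [Set.ncard_eq_toFinset_card _ (hfin n)]
    rw [Finset.card_eq_sum_card_fiberwise (f := k) (t := Finset.Icc 1 n)]
    · refine Finset.sum_congr rfl fun j hj => ?_
      rw [Set.ncard_eq_toFinset_card _ (hfib j)]
      congr 1
      ext i
      simp only [Finset.mem_Icc] at hj
      simp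
      omega
    · intro i hi
      have := hk i
      simp at hi ⊢
      omega
  have hV' : Tendsto (fun n : ℕ => (∑ j ∈ Finset.Icc 1 n, f j) / (n : ℝ)) atTop (𝓝 V) := by
    simpa only [hsum] using hV
  have hf0 : ∀ n, 0 ≤ f n := fun n => by positivity
  have hL := LSeries_tendsto_sub_mul_nhds_one_of_tendsto_sum_div_and_nonneg f hV' hf0
  have hLS : ∀ s : ℝ, 1 < s → LSeriesSummable (fun n ↦ (f n : ℂ)) s := fun s hs => by
    refine LSeriesSummable_of_sum_norm_bigO_and_nonneg ?_ hf0 zero_le_one (by simpa using hs)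
    exact Asymptotics.isBigO_atTop_natCast_rpow_of_tendsto_div_rpow (a := V) (by simpa using hV')
  have hterm : ∀ s : ℝ, 1 < s → ∀ n, LSeries.term (fun n ↦ (f n : ℂ)) s n
      = ((f n * (n : ℝ) ^ (-s) : ℝ) : ℂ) := by
    intro s hs n
    rcases eq_or_ne n 0 with rfl | hn
    · have : (-s) ≠ 0 := by linarith
      simp [Real.zero_rpow this]
    · rw [LSeries.term_of_ne_zero hn, Complex.ofReal_mul, Complex.ofReal_cpow (by positivity)]
      push_cast
      rw [Complex.cpow_neg, div_eq_mul_inv]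
  have hsr : ∀ s : ℝ, 1 < s → Summable (fun n => f n * (n : ℝ) ^ (-s)) := by
    intro s hs
    have := hLS s hs
    unfold LSeriesSummable at this
    rw [← Complex.summable_ofReal]
    exact this.congr (fun n => (hterm s hs n))
  have hinner : ∀ (s : ℝ) (n : ℕ), HasSum (fun x : {i // k i = n} => (k x.1 : ℝ) ^ (-s))
      (f n * (n : ℝ) ^ (-s)) := by
    intro s n
    have : Fintype {i // k i = n} := (hfib n).fintype
    have h1 := hasSum_fintype (fun x : {i // k i = n} => (k x.1 : ℝ) ^ (-s))
    convert h1 using 1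
    rw [Finset.sum_congr rfl (fun x _ => by rw [x.2])]
    simp only [Finset.sum_const, nsmul_eq_mul, f, Finset.card_univ]
    congr 2
    rw [← Nat.card_eq_fintype_card]
    rfl
  have hHS : ∀ s : ℝ, 1 < s → HasSum (fun i => (k i : ℝ) ^ (-s)) (∑' n, f n * (n : ℝ) ^ (-s)) := by
    intro s hs
    rw [← (Equiv.sigmaFiberEquiv k).hasSum_iff]
    have hsig : Summable ((fun i => (k i : ℝ) ^ (-s)) ∘ (Equiv.sigmaFiberEquiv k)) := by
      rw [summable_sigma_of_nonneg (fun x => by simp only [Function.comp]; positivity)]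
      refine ⟨fun n => (hinner s n).summable, ?_⟩
      refine (hsr s hs).congr fun n => ?_
      exact (hinner s n).tsum_eq.symm
    have := hsig.hasSum.sigma (fun n => hinner s n)
    rw [this.tsum_eq]
    exact hsig.hasSum
  refine ⟨fun s hs => (hHS s hs).summable, ?_⟩
  have hL2 : Tendsto (fun s : ℝ => (((s - 1) * ∑' i, (k i : ℝ) ^ (-s) : ℝ) : ℂ)) (𝓝[>] 1) (𝓝 (V : ℂ)) := by
    refine hL.congr' ?_
    filter_upwards [self_mem_nhdsWithin] with s hs
    rw [(hHS s hs).tsum_eq, LSeries, tsum_congr (hterm s hs), ← Complex.ofReal_tsum]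
    push_cast
    rfl
  exact tendsto_ofReal_iff.mp hL2

lemma aux_cmp {I : Type*} (n m : I → ℝ) (hn : ∀ i, 0 < n i) (hm : ∀ i, 0 < m i)
    (hr : Tendsto (fun i => m i / n i) cofinite (𝓝 1)) (V : ℝ)
    (hs : ∀ s : ℝ, 1 < s → Summable (fun i => (n i) ^ (-s)))
    (hV : Tendsto (fun s : ℝ => (s - 1) * ∑' i, (n i) ^ (-s)) (𝓝[>] 1) (𝓝 V)) :
    Tendsto (fun s : ℝ => (s - 1) * ∑' i, (m i) ^ (-s)) (𝓝[>] 1) (𝓝 V) := by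
  classical
  have key : ∀ ε : ℝ, 0 < ε → ∃ F : Finset I, ∀ᶠ s : ℝ in 𝓝[>] 1, ∀ i ∉ F,
      |m i ^ (-s) - n i ^ (-s)| ≤ ε * n i ^ (-s) := by
    intro ε hε
    have hc : ContinuousAt (fun p : ℝ × ℝ => p.1 ^ (-p.2)) (1, 1) :=
      ContinuousAt.rpow continuousAt_fst continuousAt_snd.neg (Or.inl one_ne_zero)
    have hc' := Metric.tendsto_nhds.mp hc ε hε
    rw [nhds_prod_eq] at hc'
    obtain ⟨pa, hpa, pb, hpb, hab⟩ := eventually_prod_iff.mp hc'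
    have hfin : {i | ¬ pa (m i / n i)}.Finite := hr.eventually hpa
    refine ⟨hfin.toFinset, ?_⟩
    filter_upwards [nhdsWithin_le_nhds hpb] with s hs i hi
    have hi' : pa (m i / n i) := by simpa using hi
    have h := hab hi' hs
    simp only [Real.dist_eq, Real.one_rpow] at h
    have hnp : 0 < n i ^ (-s) := Real.rpow_pos_of_pos (hn i) _
    rw [Real.div_rpow (hm i).le (hn i).le] at h
    have : m i ^ (-s) - n i ^ (-s) = (m i ^ (-s) / n i ^ (-s) - 1) * n i ^ (-s) := by
      field_simp
    rw [this, abs_mul, abs_of_pos hnp]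
    exact mul_le_mul_of_nonneg_right h.le hnp.le
  -- absolute difference bound
  have key2 : ∀ ε : ℝ, 0 < ε → ∃ F : Finset I, ∀ᶠ s : ℝ in 𝓝[>] 1,
      |(s - 1) * ∑' i, (m i) ^ (-s) - (s - 1) * ∑' i, (n i) ^ (-s)| ≤
      (s - 1) * ∑ i ∈ F, |m i ^ (-s) - n i ^ (-s)| + ε * ((s - 1) * ∑' i, (n i) ^ (-s)) := by
    intro ε hε
    obtain ⟨F, hF⟩ := key ε hε
    refine ⟨F, ?_⟩
    filter_upwards [hF, self_mem_nhdsWithin] with s h hs1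
    have hs1' : 0 < s - 1 := sub_pos.mpr hs1
    let G : I → ℝ := fun i => if i ∈ F then |m i ^ (-s) - n i ^ (-s)| else 0
    have hG : HasSum G (∑ i ∈ F, |m i ^ (-s) - n i ^ (-s)|) := by
      have : HasSum G (∑ i ∈ F, G i) := hasSum_sum_of_ne_finset_zero (fun i hi => by simp [G, hi])
      convert this using 1
      exact Finset.sum_congr rfl (fun i hi => by simp [G, hi])
    have hB := hG.add ((hs s hs1).hasSum.mul_left ε)
    have hle : ∀ i, ‖m i ^ (-s) - n i ^ (-s)‖ ≤ G i + ε * n i ^ (-s) := by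
      intro i
      have hnp : 0 < n i ^ (-s) := Real.rpow_pos_of_pos (hn i) _
      rw [Real.norm_eq_abs]
      by_cases hi : i ∈ F
      · simp only [G, hi, if_true]
        have := mul_pos hε hnp
        linarith
      · simp only [G, hi, if_false, zero_add]
        exact h i hi
    have hD : Summable (fun i => m i ^ (-s) - n i ^ (-s)) := Summable.of_norm_bounded hB.summable hle
    have hM : Summable (fun i => m i ^ (-s)) := by
      simpa using hD.add (hs s hs1)
    have h1 := tsum_of_norm_bounded hB hle
    rw [hM.tsum_sub (hs s hs1), Real.norm_eq_abs] at h1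
    rw [← mul_sub, abs_mul, abs_of_pos hs1']
    calc _ ≤ _ := mul_le_mul_of_nonneg_left h1 hs1'.le
      _ = _ := by ring
  have hdiff : Tendsto (fun s : ℝ => (s - 1) * ∑' i, (m i) ^ (-s) - (s - 1) * ∑' i, (n i) ^ (-s))
      (𝓝[>] 1) (𝓝 0) := by
    rw [Metric.tendsto_nhds]
    intro ε hε
    let δ := ε / (2 * (|V| + 1))
    have hδ : 0 < δ := by positivity
    obtain ⟨F, hF⟩ := key2 δ hδ
    have hlim : Tendsto (fun s : ℝ => (s - 1) * ∑ i ∈ F, |m i ^ (-s) - n i ^ (-s)| +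
        δ * ((s - 1) * ∑' i, (n i) ^ (-s))) (𝓝[>] 1) (𝓝 (0 + δ * V)) := by
      refine Tendsto.add ?_ (hV.const_mul δ)
      have hcont : ContinuousAt (fun s : ℝ => (s - 1) * ∑ i ∈ F, |m i ^ (-s) - n i ^ (-s)|) 1 := by
        refine ContinuousAt.mul (by fun_prop) ?_
        refine tendsto_finsetSum _ fun i _ => ?_
        have h1 := (hm i).ne'
        have h2 := (hn i).ne'
        exact (((continuousAt_const.rpow continuousAt_id.neg (Or.inl h1)).sub
          (continuousAt_const.rpow continuousAt_id.neg (Or.inl h2))).abs)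
      have := hcont.tendsto
      simp only [sub_self, zero_mul] at this
      exact this.mono_left nhdsWithin_le_nhds
    have hlt : 0 + δ * V < ε := by
      have : δ * V ≤ δ * (|V| + 1) := mul_le_mul_of_nonneg_left (by linarith [le_abs_self V]) hδ.le
      have h2 : δ * (|V| + 1) = ε / 2 := by
        simp only [δ]; have : |V| + 1 ≠ 0 := by positivity
        field_simp
      linarith
    filter_upwards [hF, hlim.eventually (gt_mem_nhds hlt)] with s h1 h2
    rw [Real.dist_eq, sub_zero]
    exact lt_of_le_of_lt h1 h2
  simpa using hdiff.add hV

/-- The perturbed zeta function has the same residue-type limit at `z = b` as the lattice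
zeta function: `lim_{z → b⁺} (z - b)·∑_{θ ≠ 0} ℓ(θ)^{-z} = b·V`. -/
theorem stmt_8 (b : ℕ)
    (Γ : Submodule ℤ (EuclideanSpace ℝ (Fin b))) [DiscreteTopology Γ] [IsZLattice ℝ Γ]
    (hΓ : ZLattice.covolume Γ = 1)
    (N : EuclideanSpace ℝ (Fin b) → ℝ)
    (hN0 : ∀ x, N x = 0 ↔ x = 0)
    (hNsmul : ∀ (c : ℝ) x, N (c • x) = |c| * N x)
    (hNadd : ∀ x y, N (x + y) ≤ N x + N y)
    (ℓ : EuclideanSpace ℝ (Fin b) → ℝ) (C : ℝ)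
    (hℓpos : ∀ θ : EuclideanSpace ℝ (Fin b), θ ∈ Γ → θ ≠ 0 → 0 < ℓ θ)
    (hℓ : ∀ θ : EuclideanSpace ℝ (Fin b), θ ∈ Γ → θ ≠ 0 → |ℓ θ - N θ| ≤ C) :
    Tendsto (fun z : ℝ =>
        (z - b) * ∑' θ : {x : EuclideanSpace ℝ (Fin b) // x ∈ Γ ∧ x ≠ 0}, (ℓ θ.1) ^ (-z))
      (nhdsWithin (b : ℝ) (Set.Ioi (b : ℝ)))
      (nhds ((b : ℝ) * (volume {x : EuclideanSpace ℝ (Fin b) | N x ≤ 1}).toReal)) := by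
  rcases Nat.eq_zero_or_pos b with rfl | hb
  · have : IsEmpty {x : EuclideanSpace ℝ (Fin 0) // x ∈ Γ ∧ x ≠ 0} :=
      ⟨fun x => x.2.2 (Subsingleton.elim _ _)⟩
    simp
  have hbR : (0 : ℝ) < b := by exact_mod_cast hb
  have : Nonempty (Fin b) := ⟨⟨0, hb⟩⟩
  let p : Seminorm ℝ (EuclideanSpace ℝ (Fin b)) := Seminorm.of N hNadd
    (fun c x => by rw [hNsmul, Real.norm_eq_abs])
  have hpN : ∀ x, p x = N x := fun x => rfl
  have hnn : ∀ x, 0 ≤ N x := fun x => by rw [← hpN]; exact apply_nonneg p x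
  have hpos : ∀ x, x ≠ 0 → 0 < N x := fun x hx =>
    lt_of_le_of_ne (hnn x) (fun h => hx ((hN0 x).mp h.symm))
  have hconv : ConvexOn ℝ Set.univ N := p.convexOn
  have hcont : Continuous N := hconv.locallyLipschitz.continuous
  -- lower bound
  obtain ⟨c, hc, hlow⟩ : ∃ c : ℝ, 0 < c ∧ ∀ x, c * ‖x‖ ≤ N x := by
    have hne : (Metric.sphere (0 : EuclideanSpace ℝ (Fin b)) 1).Nonempty :=
      NormedSpace.sphere_nonempty.mpr zero_le_one
    obtain ⟨x0, hx0, hmin⟩ := (isCompact_sphere (0 : EuclideanSpace ℝ (Fin b)) 1).exists_isMinOn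
      hne hcont.continuousOn
    have hx0n : x0 ≠ 0 := by
      rintro rfl
      simp at hx0
    refine ⟨N x0, hpos _ hx0n, fun x => ?_⟩
    rcases eq_or_ne x 0 with rfl | hx
    · simpa using hnn 0
    have hnx : 0 < ‖x‖ := norm_pos_iff.mpr hx
    have h1 : ‖x‖⁻¹ • x ∈ Metric.sphere (0 : EuclideanSpace ℝ (Fin b)) 1 := by
      simp [norm_smul, hnx.ne']
    have h2 : N x0 ≤ N (‖x‖⁻¹ • x) := hmin h1
    rw [hNsmul, abs_of_pos (inv_pos.mpr hnx), inv_mul_eq_div, le_div_iff₀ hnx] at h2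
    exact h2
  have hbdd : ∀ r : ℝ, Bornology.IsBounded {x | N x ≤ r} := fun r => by
    refine (Metric.isBounded_closedBall (x := (0 : EuclideanSpace ℝ (Fin b)))
      (r := r / c)).subset fun x hx => ?_
    rw [mem_closedBall_zero_iff, le_div_iff₀ hc, mul_comm]
    exact (hlow x).trans hx
  have hclosed : IsClosed (Γ : Set (EuclideanSpace ℝ (Fin b))) := by
    rw [← Submodule.coe_toAddSubgroup]
    have : DiscreteTopology Γ.toAddSubgroup := ‹DiscreteTopology Γ›
    exact AddSubgroup.isClosed_of_discrete
  have hfinE : ∀ r : ℝ, ({x | N x ≤ r} ∩ (Γ : Set (EuclideanSpace ℝ (Fin b)))).Finite := fun r =>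
    Metric.finite_isBounded_inter_isClosed DiscreteTopology.isDiscrete (hbdd r) hclosed
  let I := {x : EuclideanSpace ℝ (Fin b) // x ∈ Γ ∧ x ≠ 0}
  have hfinI : ∀ r : ℝ, {i : I | N i.1 ≤ r}.Finite := fun r => by
    refine Set.Finite.of_finite_image ((hfinE r).subset ?_) (f := Subtype.val)
      Subtype.val_injective.injOn
    rintro _ ⟨i, hi, rfl⟩
    exact ⟨hi, i.2.1⟩
  have hNtop : Tendsto (fun i : I => N i.1) cofinite atTop := by
    rw [tendsto_atTop]
    intro r
    refine (hfinI r).subset fun i hi => ?_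
    simp only [Set.mem_compl_iff, Set.mem_ofPred_eq, not_le] at hi
    exact hi.le
  have hpowle : ∀ x (r : ℝ), 0 ≤ r → (N x ^ b ≤ r ↔ N x ≤ r ^ ((b : ℝ)⁻¹)) := by
    intro x r hr
    rw [Real.le_rpow_inv_iff_of_pos (hnn x) hr hbR, Real.rpow_natCast]
  let k : I → ℕ := fun i => ⌈N i.1 ^ b⌉₊
  have hk : ∀ i, k i ≠ 0 := fun i => by
    have : 0 < N i.1 ^ b := pow_pos (hpos _ i.2.2) _
    exact (Nat.ceil_pos.mpr this).ne'
  have hkle : ∀ (n : ℕ) i, k i ≤ n ↔ N i.1 ^ b ≤ n := fun n i => Nat.ceil_le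
  have hfin : ∀ n : ℕ, {i | k i ≤ n}.Finite := fun n => by
    refine (hfinI ((n : ℝ) ^ ((b : ℝ)⁻¹))).subset fun i hi => ?_
    exact (hpowle _ _ (by positivity)).mp ((hkle n i).mp hi)
  set V : ℝ := (volume {x : EuclideanSpace ℝ (Fin b) | N x ≤ 1}).toReal with hVdef
  have hset1 : {x ∈ (Set.univ : Set (EuclideanSpace ℝ (Fin b))) | N x ^ b ≤ 1} = {x | N x ≤ 1} := by
    ext x
    simp only [Set.mem_univ, true_and, Set.mem_ofPred_eq]
    exact pow_le_one_iff_of_nonneg (hnn x) hb.ne'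
  have hcount := ZLattice.covolume.tendsto_card_le_div' Γ (X := Set.univ) (F := fun x => N x ^ b)
    (fun _ _ _ _ => trivial)
    (fun x r hr => by
      rw [hNsmul, abs_of_nonneg hr, mul_pow, finrank_euclideanSpace_fin])
    (by rw [hset1]; exact hbdd 1)
    (by rw [hset1]; exact (isClosed_le hcont continuous_const).measurableSet)
    (by
      rw [hset1]
      have : Convex ℝ {x | N x ≤ 1} := by simpa using hconv.convex_le 1
      exact this.addHaar_frontier volume)
  rw [hset1, hΓ, div_one] at hcount
  have hV : Tendsto (fun n : ℕ => ({i | k i ≤ n}.ncard : ℝ) / n) atTop (𝓝 V) := by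
    have h1 := (hcount.comp tendsto_natCast_atTop_atTop).sub (tendsto_one_div_atTop_nhds_zero_nat (𝕜 := ℝ))
    rw [sub_zero] at h1
    refine h1.congr fun n => ?_
    simp only [Function.comp]
    rw [← sub_div]
    congr 1
    set S : Set (EuclideanSpace ℝ (Fin b)) := {x | x ∈ Set.univ ∧ N x ^ b ≤ (n : ℝ)} ∩ Γ with hS
    have hSfin : S.Finite := (hfinE ((n : ℝ) ^ ((b : ℝ)⁻¹))).subset fun x hx =>
      ⟨(hpowle _ _ (by positivity)).mp hx.1.2, hx.2⟩
    have h0 : (0 : EuclideanSpace ℝ (Fin b)) ∈ S := by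
      refine ⟨⟨trivial, ?_⟩, Γ.zero_mem⟩
      rw [(hN0 0).mpr rfl, zero_pow hb.ne']
      positivity
    have himg : Subtype.val '' {i : I | k i ≤ n} = S \ {0} := by
      ext x
      constructor
      · rintro ⟨i, hi, rfl⟩
        exact ⟨⟨⟨trivial, (hkle n i).mp hi⟩, i.2.1⟩, i.2.2⟩
      · rintro ⟨⟨⟨-, hx⟩, hxΓ⟩, hx0⟩
        exact ⟨⟨x, hxΓ, hx0⟩, (hkle n _).mpr hx, rfl⟩
    rw [← Set.ncard_image_of_injective {i : I | k i ≤ n} Subtype.val_injective, himg]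
    have h2 := Set.ncard_sdiff_singleton_add_one h0 hSfin
    have h3 : (Nat.card S : ℝ) = (S \ {0}).ncard + 1 := by
      exact_mod_cast h2.symm
    rw [h3]; ring
  obtain ⟨hsum, hlim⟩ := aux_ls k hk hfin V hV
  have hratio : Tendsto (fun i : I => ℓ i.1 ^ b / (k i : ℝ)) cofinite (𝓝 1) := by
    have h1 : Tendsto (fun i : I => ℓ i.1 / N i.1) cofinite (𝓝 1) := by
      have hz : Tendsto (fun i : I => (ℓ i.1 - N i.1) / N i.1) cofinite (𝓝 0) := by
        refine squeeze_zero_norm (a := fun i : I => C / N i.1) (fun i => ?_)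
          (tendsto_const_nhds.div_atTop hNtop)
        rw [norm_div, Real.norm_eq_abs, Real.norm_eq_abs, abs_of_pos (hpos _ i.2.2)]
        exact div_le_div_of_nonneg_right (hℓ _ i.2.1 i.2.2) (hnn _)
      have := hz.add_const 1
      rw [zero_add] at this
      refine this.congr fun i => ?_
      have := (hpos _ i.2.2).ne'
      field_simp
      ring
    have h2 : Tendsto (fun i : I => (k i : ℝ) / N i.1 ^ b) cofinite (𝓝 1) :=
      (tendsto_nat_ceil_div_atTop (R := ℝ)).comp ((tendsto_pow_atTop hb.ne').comp hNtop)
    have h3 := (h1.pow b).div h2 one_ne_zero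
    rw [one_pow, div_one] at h3
    refine h3.congr fun i => ?_
    have e1 := (hpos _ i.2.2).ne'
    have e2 : (k i : ℝ) ≠ 0 := by exact_mod_cast hk i
    simp only [Pi.div_apply]
    field_simp
    rw [← mul_pow, div_mul_cancel₀ _ e1]
  have hfinal := aux_cmp (fun i => (k i : ℝ)) (fun i : I => ℓ i.1 ^ b)
    (fun i => by exact_mod_cast Nat.pos_of_ne_zero (hk i))
    (fun i => pow_pos (hℓpos _ i.2.1 i.2.2) b) hratio V hsum hlim
  have hdiv : Tendsto (fun z : ℝ => z / b) (𝓝[>] (b : ℝ)) (𝓝[>] 1) := by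
    refine tendsto_nhdsWithin_iff.mpr ⟨?_, ?_⟩
    · have : Tendsto (fun z : ℝ => z / b) (𝓝 (b : ℝ)) (𝓝 ((b : ℝ) / b)) :=
        (continuous_id.div_const _).tendsto _
      rw [div_self hbR.ne'] at this
      exact this.mono_left nhdsWithin_le_nhds
    · filter_upwards [self_mem_nhdsWithin] with z hz
      exact (one_lt_div hbR).mpr hz
  refine ((hfinal.comp hdiv).const_mul (b : ℝ)).congr fun z => ?_
  simp only [Function.comp]
  have e : ∀ i : I, (ℓ i.1 ^ b) ^ (-(z / b)) = ℓ i.1 ^ (-z) := fun i => by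
    rw [← Real.rpow_natCast, ← Real.rpow_mul (hℓpos _ i.2.1 i.2.2).le]
    congr 1
    field_simp
  rw [tsum_congr e, ← mul_assoc]
  congr 1
  field_simp
end
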